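/- Let g be a finite-dimensional real Lie algebra and let a be an abelian Lie subalgebra of g such that, for every H ∈ a, the inner derivation ad(H) is a semisimple linear endomorphism of g. Then there exists a Levi subalgebra l of g that is ad(a)-invariant, i.e., ⁅H, x⁆ ∈ l for all H ∈ a and x ∈ l. -/

import Mathlib

/-- `l` is a Levi subalgebra of `g`: a semisimple Lie subalgebra that is a vector-space
complement of the radical of `g`. -/
def IsLeviSubalgebra (g : Type*) [LieRing g] [LieAlgebra ℝ g]
    (l : LieSubalgebra ℝ g) : Prop :=
  LieAlgebra.IsSemisimple ℝ l ∧
    IsCompl l.toSubmodule (LieAlgebra.radical ℝ g).toSubmodule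

open LieAlgebra LieModule LieModule.Cohomology Module

section Cohomology

variable {K S M : Type*} [Field K] [CharZero K] [LieRing S] [LieAlgebra K S]
  [FiniteDimensional K S] [HasTrivialRadical K S]
  [AddCommGroup M] [Module K M] [LieRingModule S M] [LieModule K S M]

/-- A 2-cocycle of a semisimple Lie algebra with values in a trivial module is a coboundary. -/
lemma exists_d₁₂_eq_of_isTrivial [FiniteDimensional K M] [IsTrivial S M]
    (c : twoCocycle K S M) : ∃ h : oneCochain K S M, d₁₂ K S M h = c := by
  have hc := (mem_twoCocycle_iff_of_trivial K S M c.1).mp c.2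
  have key (φ : Dual K M) : ∃ z : S, ∀ x y, φ (c.1 x y) = killingForm K S z ⁅x, y⁆ := by
    have hnd := IsKilling.killingForm_nondegenerate K S
    let e := (killingForm K S).toDual hnd
    have he (x y : S) : killingForm K S (e.symm (φ ∘ₗ c.1.1 x)) y = φ (c.1 x y) :=
      LinearMap.BilinForm.apply_toDual_symm_apply _ _
    let D : LieDerivation K S S :=
      { toLinearMap := e.symm.toLinearMap ∘ₗ (LinearMap.llcomp K S M K φ) ∘ₗ c.1.1
        leibniz' := fun a b ↦ by
          refine e.injective (LinearMap.ext fun y ↦ ?_)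
          change killingForm K S (e.symm (φ ∘ₗ c.1.1 ⁅a, b⁆)) y =
            killingForm K S (⁅a, e.symm (φ ∘ₗ c.1.1 b)⁆ - ⁅b, e.symm (φ ∘ₗ c.1.1 a)⁆) y
          rw [map_sub, LinearMap.sub_apply, traceForm_apply_lie_apply', traceForm_apply_lie_apply',
            he, he, he, hc a b y, map_add]
          ring }
    obtain ⟨z, hz⟩ := LieDerivation.IsKilling.exists_eq_ad D
    refine ⟨z, fun x y ↦ ?_⟩
    have : D x = ⁅z, x⁆ := by simp [← hz]
    rw [← he, ← traceForm_apply_lie_apply, ← this]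
    rfl
  let b := finBasis K M
  choose z hz using fun i ↦ key (b.coord i)
  refine ⟨-∑ i, (killingForm K S (z i)).smulRight (b i),
    Subtype.ext (LinearMap.ext₂ fun x y ↦ ?_)⟩
  change d₁₂ K S M _ x y = c.1 x y
  rw [d₁₂_apply_apply_ofTrivial, ← b.sum_repr (c.1 x y)]
  simp [← hz]

/-- The trace form of an irreducible module is non-degenerate on any ideal that meets the kernel
of the action trivially. -/
lemma traceForm_separating_of_disjoint_ker [FiniteDimensional K M] [IsIrreducible K S M]
    {I : LieIdeal K S} (hI : Disjoint I (LieModule.ker K S M)) {x : S} (hxI : x ∈ I)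
    (hx : ∀ y ∈ I, traceForm K S M x y = 0) : x = 0 := by
  let N : LieIdeal K S :=
    { carrier := {x | x ∈ I ∧ ∀ y ∈ I, traceForm K S M x y = 0}
      add_mem' := fun ha hb ↦ ⟨I.add_mem ha.1 hb.1, fun y hy ↦ by simp [ha.2 y hy, hb.2 y hy]⟩
      zero_mem' := ⟨I.zero_mem, by simp⟩
      smul_mem' := fun t a ha ↦ ⟨I.smul_mem t ha.1, fun y hy ↦ by simp [ha.2 y hy]⟩
      lie_mem := fun {a b} hb ↦ ⟨I.lie_mem hb.1, fun y hy ↦ by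
        rw [traceForm_apply_lie_apply', hb.2 _ (I.lie_mem hy), neg_zero]⟩ }
  suffices N = ⊥ by
    have hxN : x ∈ N := ⟨hxI, hx⟩
    rwa [this, LieSubmodule.mem_bot] at hxN
  have hN0 : traceForm K N M = 0 := by
    ext ⟨a, ha⟩ ⟨b, hb⟩
    exact ha.2 b hb.1
  have hnil := isNilpotent_derivedSeries_of_traceForm_eq_zero hN0
  have : Nontrivial M := nontrivial_of_isIrreducible K S M
  let P : LieIdeal K S := ⁅N, N⁆
  have hPN : P ≤ N := LieSubmodule.lie_le_left N N
  let T : LieSubmodule K S M :=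
    { carrier := {m | ∀ p ∈ P, ⁅p, m⁆ = 0}
      add_mem' := fun ha hb p hp ↦ by simp [ha p hp, hb p hp]
      zero_mem' := by simp
      smul_mem' := fun t a ha p hp ↦ by simp [ha p hp]
      lie_mem := fun {a m} hm p hp ↦ by
        rw [leibniz_lie, hm p hp, lie_zero, add_zero]
        exact hm _ (lie_mem_left K S P p a hp) }
  have := nontrivial_max_triv_of_isNilpotent K (derivedSeries K N 1) M
  obtain ⟨⟨m, hm⟩, hm0⟩ := exists_ne (0 : maxTrivSubmodule K (derivedSeries K N 1) M)
  have hmT : m ∈ T := fun p hp ↦ by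
    have : (⟨p, hPN hp⟩ : N) ∈ derivedSeries K N 1 := by
      rw [LieIdeal.derivedSeries_eq_derivedSeriesOfIdeal_comap, LieIdeal.mem_comap]
      exact hp
    exact hm ⟨_, this⟩
  have hT : T = ⊤ := (eq_bot_or_eq_top T).resolve_left fun h ↦ by
    rw [h, LieSubmodule.mem_bot] at hmT
    exact hm0 (Subtype.ext hmT)
  have hP : P = ⊥ := by
    rw [← le_bot_iff, ← disjoint_iff_inf_le.mp hI |>.antisymm bot_le]
    refine le_inf (hPN.trans fun a ha ↦ ha.1) fun p hp ↦ ?_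
    rw [LieModule.mem_ker]
    exact fun m ↦ (hT ▸ LieSubmodule.mem_top m : m ∈ T) p hp
  have : IsLieAbelian N := (LieSubmodule.lie_abelian_iff_lie_self_eq_bot N).mpr hP
  exact IsKilling.ideal_eq_bot_of_isLieAbelian N

/-- A nontrivial irreducible module has an invariant tensor in `S ⊗ S` with non-zero trace. -/
lemma exists_casimir [FiniteDimensional K M] [IsIrreducible K S M] (hM : ¬ IsTrivial S M) :
    ∃ (n : ℕ) (e e' : Fin n → S),
      (∀ (x : S) (F : S →ₗ[K] S →ₗ[K] M), ∑ i, (F ⁅x, e i⁆ (e' i) + F (e i) ⁅x, e' i⁆) = 0) ∧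
      ∑ i, toEnd K S M (e i) ∘ₗ toEnd K S M (e' i) ≠ 0 := by
  have hcompl := LieIdeal.isCompl_killingCompl (LieModule.ker K S M)
  set I := (LieModule.ker K S M).killingCompl
  have hI : I ≠ ⊥ := by
    intro h
    have htop : LieModule.ker K S M = ⊤ := by simpa [h] using hcompl.sup_eq_top
    exact hM ⟨fun x m ↦ (LieModule.mem_ker K S M x).mp (htop ▸ LieSubmodule.mem_top x) m⟩
  let B : LinearMap.BilinForm K I := (traceForm K S M).restrict I.toSubmodule
  have hBsymm : B.IsSymm := ⟨fun x y ↦ traceForm_comm K S M x y⟩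
  have hB : B.Nondegenerate :=
    (LinearMap.IsRefl.nondegenerate_iff_separatingLeft hBsymm.isRefl).mpr fun x hx ↦
      Subtype.ext <| traceForm_separating_of_disjoint_ker hcompl.disjoint.symm x.2
        fun y hy ↦ hx ⟨y, hy⟩
  let b := finBasis K I
  let b' := B.dualBasis hB b
  have hb (x : I) : ∑ i, B x (b' i) • b i = x := by
    conv_rhs => rw [← b.sum_repr x]
    rw [← LinearMap.BilinForm.dualBasis_dualBasis hB hBsymm b]
    simp only [LinearMap.BilinForm.dualBasis_repr_apply, b']
  have hb' (x : I) : ∑ i, B x (b i) • b' i = x := by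
    conv_rhs => rw [← b'.sum_repr x]
    simp only [LinearMap.BilinForm.dualBasis_repr_apply, b']
  refine ⟨_, fun i ↦ b i, fun i ↦ b' i, fun x F ↦ ?_, fun h ↦ ?_⟩
  · have h₁ (i) : F ⁅x, (b i : S)⁆ (b' i) = ∑ j, B ⁅x, b i⁆ (b' j) • F (b j) (b' i) := by
      have : ⁅x, (b i : S)⁆ = ((⁅x, b i⁆ : I) : S) := rfl
      conv_lhs => rw [this, ← hb ⁅x, b i⁆]
      simp
    have h₂ (i) : F (b i) ⁅x, (b' i : S)⁆ = ∑ j, B ⁅x, b' i⁆ (b j) • F (b i) (b' j) := by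
      have : ⁅x, (b' i : S)⁆ = ((⁅x, b' i⁆ : I) : S) := rfl
      conv_lhs => rw [this, ← hb' ⁅x, b' i⁆]
      simp
    simp_rw [Finset.sum_add_distrib, h₁, h₂]
    rw [Finset.sum_comm, ← Finset.sum_add_distrib]
    refine Finset.sum_eq_zero fun i _ ↦ ?_
    rw [← Finset.sum_add_distrib]
    refine Finset.sum_eq_zero fun j _ ↦ ?_
    have : B ⁅x, b j⁆ (b' i) = - B ⁅x, b' i⁆ (b j) := by
      rw [hBsymm.eq ⁅x, b' i⁆]
      exact traceForm_apply_lie_apply' K S M x (b j) (b' i)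
    rw [this, neg_smul, neg_add_cancel]
  · have htr : LinearMap.trace K M
        (∑ i, toEnd K S M (b i) ∘ₗ toEnd K S M (b' i)) = finrank K I := by
      rw [map_sum]
      have h₁ (i) : LinearMap.trace K M (toEnd K S M (b i) ∘ₗ toEnd K S M (b' i)) = 1 := by
        change B (b i) (b' i) = 1
        rw [LinearMap.BilinForm.apply_dualBasis_right hB hBsymm, if_pos rfl]
      simp [h₁]
    rw [h, map_zero, eq_comm, Nat.cast_eq_zero] at htr
    apply hI
    rw [← LieSubmodule.toSubmodule_eq_bot]
    exact Submodule.finrank_eq_zero.mp htr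

/-- **Whitehead's second lemma** for irreducible modules. -/
lemma exists_d₁₂_eq_of_isIrreducible [FiniteDimensional K M] [IsIrreducible K S M]
    (c : twoCocycle K S M) : ∃ h : oneCochain K S M, d₁₂ K S M h = c := by
  by_cases hM : IsTrivial S M
  · exact exists_d₁₂_eq_of_isTrivial c
  obtain ⟨n, e, e', hinv, hne⟩ := exists_casimir (K := K) hM
  let C : M →ₗ⁅K,S⁆ M :=
    { ∑ i, toEnd K S M (e i) ∘ₗ toEnd K S M (e' i) with
      map_lie' := fun {x m} ↦ by
        have := hinv x (LinearMap.mk₂ K (fun a b ↦ ⁅a, ⁅b, m⁆⁆) (by simp) (by simp) (by simp)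
          (by simp))
        have h (i) : ⁅e i, ⁅e' i, ⁅x, m⁆⁆⁆ = ⁅x, ⁅e i, ⁅e' i, m⁆⁆⁆ -
            (⁅⁅x, e i⁆, ⁅e' i, m⁆⁆ + ⁅e i, ⁅⁅x, e' i⁆, m⁆⁆) := by
          simp only [lie_lie, lie_sub]
          abel
        simp only [LinearMap.mk₂_apply] at this
        simp only [AddHom.toFun_eq_coe, LinearMap.coe_toAddHom, LinearMap.sum_apply,
          LinearMap.comp_apply, toEnd_apply_apply, h, Finset.sum_sub_distrib, this, sub_zero,
          lie_sum] }
  have hC (m : M) : C m = ∑ i, ⁅e i, ⁅e' i, m⁆⁆ := by simp [C]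
  have hinj : Function.Injective C := by
    rw [← LieModuleHom.ker_eq_bot]
    refine (eq_bot_or_eq_top C.ker).resolve_right fun h ↦ hne (LinearMap.ext fun m ↦ ?_)
    exact (LieModuleHom.mem_ker).mp (h ▸ LieSubmodule.mem_top m : m ∈ C.ker)
  let C' := LinearEquiv.ofInjectiveEndo C.toLinearMap hinj
  have hC' (m : M) : C' m = C m := rfl
  let g : S →ₗ[K] M := ∑ i, toEnd K S M (e i) ∘ₗ c.1.1 (e' i)
  have hg (x : S) : g x = ∑ i, ⁅e i, c.1 (e' i) x⁆ := by simp [g]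
  have hdg (x y : S) : ⁅x, g y⁆ - ⁅y, g x⁆ - g ⁅x, y⁆ = C (c.1 x y) := by
    have hx := hinv x (LinearMap.mk₂ K (fun a b ↦ ⁅a, c.1 b y⁆) (by simp) (by simp) (by simp)
      (by simp))
    have hy := hinv y (LinearMap.mk₂ K (fun a b ↦ ⁅a, c.1 b x⁆) (by simp) (by simp) (by simp)
      (by simp))
    simp only [LinearMap.mk₂_apply] at hx hy
    have hcoc (i) : d₂₃ K S M c.1 (e' i) x y = 0 := by
      rw [(mem_twoCocycle_iff K S M c.1).mp c.2]; rfl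
    have h (i) : ⁅x, ⁅e i, c.1 (e' i) y⁆⁆ - ⁅y, ⁅e i, c.1 (e' i) x⁆⁆ - ⁅e i, c.1 (e' i) ⁅x, y⁆⁆
        = ⁅e i, ⁅e' i, c.1 x y⁆⁆ + (⁅⁅x, e i⁆, c.1 (e' i) y⁆ + ⁅e i, c.1 ⁅x, e' i⁆ y⁆)
          - (⁅⁅y, e i⁆, c.1 (e' i) x⁆ + ⁅e i, c.1 ⁅y, e' i⁆ x⁆) := by
      have := congrArg (⁅e i, ·⁆) (hcoc i)
      simp only [d₂₃_apply, lie_zero, lie_sub, lie_add] at this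
      rw [← twoCochain_skew c.1 (e' i) ⁅x, y⁆, ← lie_skew (e' i) x,
        ← lie_skew (e' i) y] at this
      simp only [map_neg, LinearMap.neg_apply, lie_neg] at this
      simp only [lie_lie]
      rw [← sub_eq_zero, ← neg_eq_zero, ← this]
      abel
    simp only [hC, hg, lie_sum, ← Finset.sum_sub_distrib, h]
    rw [Finset.sum_sub_distrib, Finset.sum_add_distrib, hx, hy, add_zero, sub_zero]
  have hlie (x : S) (m : M) : C'.symm ⁅x, m⁆ = ⁅x, C'.symm m⁆ := by
    rw [LinearEquiv.symm_apply_eq, hC', LieModuleHom.map_lie, ← hC', LinearEquiv.apply_symm_apply]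
  refine ⟨C'.symm.toLinearMap ∘ₗ g, Subtype.ext (LinearMap.ext₂ fun x y ↦ ?_)⟩
  change d₁₂ K S M _ x y = c.1 x y
  rw [d₁₂_apply_apply, ← C'.symm_apply_apply (c.1 x y), hC', ← hdg]
  simp [hlie]

end Cohomology

section Splitting

variable {K L S : Type*} [Field K] [LieRing L] [LieAlgebra K L] [LieRing S] [LieAlgebra K S]

/-- A surjection onto a semisimple Lie algebra whose kernel is an abelian minimal ideal splits. -/
lemma exists_section_of_isLieAbelian_of_minimal [CharZero K] [FiniteDimensional K L]
    [FiniteDimensional K S] [HasTrivialRadical K S] (f : L →ₗ⁅K⁆ S) (hf : Function.Surjective f)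
    [IsLieAbelian f.ker] (hne : f.ker ≠ ⊥)
    (hmin : ∀ n : LieIdeal K L, n ≤ f.ker → n = ⊥ ∨ n = f.ker) :
    ∃ σ : S →ₗ⁅K⁆ L, ∀ x, f (σ x) = x := by
  obtain ⟨s, hs⟩ := f.toLinearMap.exists_rightInverse_of_surjective (LinearMap.range_eq_top.mpr hf)
  replace hs (x : S) : f (s x) = x := LinearMap.congr_fun hs x
  have habel {a b : L} (ha : f a = 0) (hb : f b = 0) : ⁅a, b⁆ = 0 :=
    congrArg Subtype.val (trivial_lie_zero f.ker f.ker ⟨a, ha⟩ ⟨b, hb⟩)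
  have hact (x y : S) (m : f.ker) : ⁅s ⁅x, y⁆, m⁆ = ⁅⁅s x, s y⁆, m⁆ := by
    refine Subtype.ext (sub_eq_zero.mp ?_)
    change ⁅s ⁅x, y⁆, (m : L)⁆ - ⁅⁅s x, s y⁆, (m : L)⁆ = 0
    rw [← sub_lie]
    exact habel (by simp [hs]) m.2
  let : LieRingModule S f.ker :=
    { bracket x m := ⁅s x, m⁆
      add_lie x y m := by
        change ⁅s (x + y), m⁆ = ⁅s x, m⁆ + ⁅s y, m⁆
        rw [map_add, add_lie]
      lie_add x m n := lie_add (s x) m n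
      leibniz_lie x y m := by
        change ⁅s x, ⁅s y, m⁆⁆ = ⁅s ⁅x, y⁆, m⁆ + ⁅s y, ⁅s x, m⁆⁆
        rw [hact, lie_lie, sub_add_cancel] }
  have hlie (x : S) (m : f.ker) : ((⁅x, m⁆ : f.ker) : L) = ⁅s x, (m : L)⁆ := rfl
  have : LieModule K S f.ker :=
    { smul_lie t x m := Subtype.ext (by simp [hlie])
      lie_smul t x m := Subtype.ext (by simp [hlie]) }
  have : IsIrreducible K S f.ker := by
    have : Nontrivial f.ker := (LieSubmodule.nontrivial_iff_ne_bot K L L).mpr hne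
    refine IsIrreducible.mk fun N hN ↦ ?_
    let n : LieIdeal K L :=
      { N.toSubmodule.map f.ker.toSubmodule.subtype with
        lie_mem := fun {x m} hm ↦ by
          obtain ⟨m, hm, rfl⟩ := hm
          refine ⟨⁅f x, m⁆, N.lie_mem hm, sub_eq_zero.mp ?_⟩
          change ⁅s (f x), (m : L)⁆ - ⁅x, (m : L)⁆ = 0
          rw [← sub_lie]
          exact habel (by simp [hs]) m.2 }
    have hn (m : f.ker) : (m : L) ∈ n ↔ m ∈ N :=
      ⟨fun ⟨m', hm', h⟩ ↦ (Subtype.ext h : m' = m) ▸ hm', fun h ↦ ⟨m, h, rfl⟩⟩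
    rcases hmin n (by rintro _ ⟨m, -, rfl⟩; exact m.2) with h | h
    · refine (hN ((LieSubmodule.eq_bot_iff N).mpr fun m hm ↦ Subtype.ext ?_)).elim
      have := (hn m).mpr hm
      rwa [h] at this
    · refine eq_top_iff.mpr fun m _ ↦ (hn m).mp ?_
      rw [h]
      exact m.2
  let c₀ : S →ₗ[K] S →ₗ[K] f.ker := LinearMap.mk₂ K
    (fun x y ↦ ⟨⁅s x, s y⁆ - s ⁅x, y⁆, by simp [hs]⟩)
    (fun x y z ↦ Subtype.ext (by simp; abel)) (fun t x y ↦ Subtype.ext (by simp [smul_sub]))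
    (fun x y z ↦ Subtype.ext (by simp; abel)) (fun t x y ↦ Subtype.ext (by simp [smul_sub]))
  let c₁ : twoCochain K S f.ker := ⟨c₀, fun x ↦ Subtype.ext (by simp [c₀])⟩
  have hc₁ (x y : S) : (c₁ x y : L) = ⁅s x, s y⁆ - s ⁅x, y⁆ := rfl
  have hcoc : c₁ ∈ twoCocycle K S f.ker := by
    rw [mem_twoCocycle_iff]
    ext x y z
    rw [d₂₃_apply]
    simp only [LieSubmodule.coe_sub, LieSubmodule.coe_add, hlie, hc₁, LinearMap.zero_apply,
      LieSubmodule.coe_zero, lie_sub]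
    rw [← lie_skew (s ⁅x, z⁆) (s y), ← lie_skew (s ⁅y, z⁆) (s x), ← lie_skew (s ⁅x, y⁆) (s z),
      ← lie_skew ⁅x, z⁆ y, ← lie_skew ⁅y, z⁆ x, leibniz_lie (s x) (s y) (s z),
      ← lie_skew (s z), leibniz_lie x y z]
    simp only [map_add, map_neg]
    abel
  obtain ⟨h, hh⟩ := exists_d₁₂_eq_of_isIrreducible ⟨c₁, hcoc⟩
  have hfh (x : S) : f (h x) = 0 := (h x).2
  refine ⟨{ s - f.ker.toSubmodule.subtype ∘ₗ h with map_lie' := fun {x y} ↦ ?_ }, fun x ↦ ?_⟩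
  · change s ⁅x, y⁆ - h ⁅x, y⁆ = ⁅s x - (h x : L), s y - (h y : L)⁆
    have := congrArg (fun c : twoCochain K S f.ker ↦ (c x y : L)) hh
    change ((⁅x, h y⁆ - ⁅y, h x⁆ - h ⁅x, y⁆ : f.ker) : L) = ⁅s x, s y⁆ - s ⁅x, y⁆ at this
    simp only [LieSubmodule.coe_sub, hlie] at this
    rw [lie_sub, sub_lie, sub_lie, habel (hfh x) (hfh y), sub_zero, ← lie_skew (h x : L),
      ← sub_eq_zero]
    rw [← sub_eq_zero] at this
    rw [← this]
    abel
  · change f (s x - h x) = x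
    rw [map_sub, hs, hfh, sub_zero]


/-- `f` admits a Lie algebra section intertwining the endomorphisms `E i` of its target with the
endomorphisms `D i` of its source. -/
def HasInvariantSection {ι : Type*} (f : L →ₗ⁅K⁆ S) (D : ι → End K L) (E : ι → End K S) : Prop :=
  ∃ σ : S →ₗ⁅K⁆ L, (∀ x, f (σ x) = x) ∧ ∀ i x, D i (σ x) = σ (E i x)

/-- If `f` has an invariant section modulo an invariant ideal `n` in its kernel, and so does its
restriction to every invariant subalgebra that surjects onto `S` with kernel inside `n`, then `f`
has an invariant section. -/
lemma HasInvariantSection.of_quotient {ι : Type*} {f : L →ₗ⁅K⁆ S} {D : ι → End K L}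
    {E : ι → End K S} {n : LieIdeal K L} (hn : n ≤ f.ker) (hDn : ∀ i, ∀ x ∈ n, D i x ∈ n)
    (hquot : ∀ (f' : L ⧸ n →ₗ⁅K⁆ S) (D' : ι → End K (L ⧸ n)),
      (∀ x, f' (LieSubmodule.Quotient.mk x) = f x) →
      (∀ i x, D' i (LieSubmodule.Quotient.mk x) = LieSubmodule.Quotient.mk (D i x)) →
      HasInvariantSection f' D' E)
    (hsub : ∀ (L₁ : LieSubalgebra K L) (hD : ∀ i, ∀ x ∈ L₁, D i x ∈ L₁),
      Function.Surjective (f.comp L₁.incl) → (∀ x ∈ L₁, f x = 0 → x ∈ n) →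
      HasInvariantSection (f.comp L₁.incl)
        (fun i ↦ (D i).restrict (p := L₁.toSubmodule) (hD i)) E) :
    HasInvariantSection f D E := by
  let f' : L ⧸ n →ₗ⁅K⁆ S :=
    { n.toSubmodule.liftQ f.toLinearMap hn with
      map_lie' := fun {x y} ↦ by
        obtain ⟨x, rfl⟩ := LieSubmodule.Quotient.surjective_mk' n x
        obtain ⟨y, rfl⟩ := LieSubmodule.Quotient.surjective_mk' n y
        exact f.map_lie x y }
  have hf' (x : L) : f' (LieSubmodule.Quotient.mk x) = f x := rfl
  let D' (i) : End K (L ⧸ n) := n.toSubmodule.mapQ n.toSubmodule (D i) (hDn i)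
  obtain ⟨τ, hτ, hDτ⟩ := hquot f' D' hf' fun _ _ ↦ rfl
  let π : L →ₗ⁅K⁆ L ⧸ n :=
    { n.toSubmodule.mkQ with map_lie' := fun {x y} ↦ LieSubmodule.Quotient.mk_bracket n x y }
  have hπ (x : L) : π x = LieSubmodule.Quotient.mk x := rfl
  have hπsurj : Function.Surjective π := LieSubmodule.Quotient.surjective_mk' n
  let L₁ : LieSubalgebra K L := τ.range.comap π
  have hL₁ (x : L) : x ∈ L₁ ↔ ∃ y, τ y = π x := Iff.rfl
  have hDL₁ (i) (x : L) (hx : x ∈ L₁) : D i x ∈ L₁ := by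
    obtain ⟨y, hy⟩ := (hL₁ x).mp hx
    exact (hL₁ _).mpr ⟨E i y, by rw [← hDτ, hy]; rfl⟩
  obtain ⟨σ, hσ, hDσ⟩ := hsub L₁ hDL₁ (fun y ↦ by
      obtain ⟨x, hx⟩ := hπsurj (τ y)
      exact ⟨⟨x, (hL₁ x).mpr ⟨y, hx.symm⟩⟩, by
        change f x = y
        rw [← hf', ← hπ, hx, hτ]⟩) fun x hx hfx ↦ by
      obtain ⟨y, hy⟩ := (hL₁ x).mp hx
      have hy0 : y = 0 := by rw [← hτ y, hy, hπ, hf', hfx]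
      rw [hy0, map_zero] at hy
      exact LieSubmodule.Quotient.mk_eq_zero'.mp hy.symm
  exact ⟨L₁.incl.comp σ, hσ, fun i x ↦ congrArg Subtype.val (hDσ i x)⟩

lemma finrank_quotient_lt [FiniteDimensional K L] {n : LieIdeal K L} (hn : n ≠ ⊥) :
    finrank K (L ⧸ n) < finrank K L := by
  have h : finrank K (L ⧸ n) + finrank K n = finrank K L :=
    n.toSubmodule.finrank_quotient_add_finrank
  have : finrank K n ≠ 0 := fun h ↦ hn <| by
    rw [← LieSubmodule.toSubmodule_eq_bot]
    exact Submodule.finrank_eq_zero.mp h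
  omega

lemma finrank_lt_of_ker_not_le [FiniteDimensional K L] {f : L →ₗ⁅K⁆ S} {n : LieIdeal K L}
    (hn : ¬ f.ker ≤ n) {L₁ : LieSubalgebra K L} (h : ∀ x ∈ L₁, f x = 0 → x ∈ n) :
    finrank K L₁ < finrank K L :=
  Submodule.finrank_lt (s := L₁.toSubmodule) fun htop ↦
    hn fun x hx ↦ h x ((htop ▸ Submodule.mem_top : x ∈ L₁.toSubmodule)) hx

lemma isSolvable_ker_of_quotient {f : L →ₗ⁅K⁆ S} {n : LieIdeal K L} [IsSolvable f.ker]
    {f' : L ⧸ n →ₗ⁅K⁆ S} (h : ∀ x, f' (LieSubmodule.Quotient.mk x) = f x) :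
    IsSolvable f'.ker := by
  let g : f.ker →ₗ⁅K⁆ f'.ker :=
    { toFun x := ⟨LieSubmodule.Quotient.mk x.1, (h x.1).trans x.2⟩
      map_add' _ _ := rfl
      map_smul' _ _ := rfl
      map_lie' := fun {x y} ↦ Subtype.ext (LieSubmodule.Quotient.mk_bracket n x.1 y.1) }
  refine Function.Surjective.lieAlgebra_isSolvable (f := g) fun ⟨y, hy⟩ ↦ ?_
  obtain ⟨x, rfl⟩ := LieSubmodule.Quotient.surjective_mk' n y
  exact ⟨⟨x, (h x).symm.trans hy⟩, rfl⟩

lemma isSolvable_ker_comp_incl {f : L →ₗ⁅K⁆ S} [IsSolvable f.ker] (L₁ : LieSubalgebra K L) :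
    IsSolvable (f.comp L₁.incl).ker := by
  let g : (f.comp L₁.incl).ker →ₗ⁅K⁆ f.ker :=
    { toFun x := ⟨x.1.1, x.2⟩
      map_add' _ _ := rfl
      map_smul' _ _ := rfl
      map_lie' := fun {x y} ↦ rfl }
  exact Function.Injective.lieAlgebra_isSolvable (f := g) fun x y hxy ↦
    Subtype.ext (Subtype.ext (congrArg (fun z : f.ker ↦ (z : L)) hxy))

lemma eq_bot_of_le_lie_self {I : LieIdeal K L} [hI : IsSolvable I] (h : I ≤ ⁅I, I⁆) : I = ⊥ := by
  obtain ⟨k, hk⟩ := IsSolvable.solvable K I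
  rw [LieIdeal.derivedSeries_eq_bot_iff] at hk
  have (k : ℕ) : derivedSeriesOfIdeal K L k I = I := by
    induction k with
    | zero => rfl
    | succ k ih => rw [derivedSeriesOfIdeal_succ, ih, (LieSubmodule.lie_le_left I I).antisymm h]
  rw [← this k, hk]

end Splitting

section Semisimple

variable {K V W ι : Type*} [Field K] [AddCommGroup V] [Module K V] [AddCommGroup W] [Module K W]

lemma apply_aeval_eq_of_semiconj {f : V →ₗ[K] W} {S : End K V} {T : End K W}
    (h : ∀ x, T (f x) = f (S x)) (p : Polynomial K) (x : V) :
    Polynomial.aeval T p (f x) = f (Polynomial.aeval S p x) := by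
  have hpow (n : ℕ) (x : V) : (T ^ n) (f x) = f ((S ^ n) x) := by
    induction n generalizing x with
    | zero => rfl
    | succ n ih => rw [pow_succ, pow_succ, Module.End.mul_apply, Module.End.mul_apply, h, ih]
  induction p using Polynomial.induction_on' with
  | add p q hp hq => simp [hp, hq]
  | monomial n a => simp [Polynomial.aeval_monomial, hpow, Module.algebraMap_end_apply]

lemma Module.End.IsSemisimple.of_surjective [FiniteDimensional K V] {f : V →ₗ[K] W}
    (hf : Function.Surjective f) {S : End K V} {T : End K W} (h : ∀ x, T (f x) = f (S x))
    (hS : S.IsSemisimple) : T.IsSemisimple := by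
  refine Module.End.isSemisimple_of_squarefree_aeval_eq_zero hS.minpoly_squarefree
    (LinearMap.ext fun y ↦ ?_)
  obtain ⟨x, rfl⟩ := hf y
  rw [apply_aeval_eq_of_semiconj h, minpoly.aeval, LinearMap.zero_apply, map_zero,
    LinearMap.zero_apply]

/-- The endomorphism `φ ↦ S ∘ φ - φ ∘ T` of the space of linear maps. -/
@[simps]
def commutatorEnd (S : End K V) (T : End K W) : End K (W →ₗ[K] V) where
  toFun φ := S ∘ₗ φ - φ ∘ₗ T
  map_add' φ ψ := by ext; simp; abel
  map_smul' t φ := by ext; simp [smul_sub]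

lemma isSemisimple_commutatorEnd [PerfectField K] [FiniteDimensional K V] [FiniteDimensional K W]
    {S : End K V} {T : End K W} (hS : S.IsSemisimple) (hT : T.IsSemisimple) :
    (commutatorEnd S T).IsSemisimple := by
  let A : End K (W →ₗ[K] V) := S.compRight K
  let B : End K (W →ₗ[K] V) := LinearMap.lcomp K V T
  have hA : A.IsSemisimple := by
    refine Module.End.isSemisimple_of_squarefree_aeval_eq_zero hS.minpoly_squarefree
      (LinearMap.ext fun φ ↦ LinearMap.ext fun x ↦ ?_)
    have := apply_aeval_eq_of_semiconj (f := LinearMap.applyₗ x) (S := A) (T := S)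
      (fun φ ↦ rfl) (minpoly K S) φ
    rw [minpoly.aeval] at this
    exact this.symm
  have hB : B.IsSemisimple := by
    refine Module.End.isSemisimple_of_squarefree_aeval_eq_zero hT.minpoly_squarefree
      (LinearMap.ext fun φ ↦ ?_)
    have (p : Polynomial K) : Polynomial.aeval B p φ = φ ∘ₗ Polynomial.aeval T p := by
      have hpow (n : ℕ) (φ : W →ₗ[K] V) : (B ^ n) φ = φ ∘ₗ (T ^ n) := by
        induction n generalizing φ with
        | zero => rfl
        | succ n ih =>
          rw [pow_succ, pow_succ', Module.End.mul_apply, ih]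
          rfl
      induction p using Polynomial.induction_on' with
      | add p q hp hq => simp [hp, hq, LinearMap.comp_add]
      | monomial n a =>
        ext x
        simp [Polynomial.aeval_monomial, hpow, Module.algebraMap_end_apply]
    rw [this, minpoly.aeval, LinearMap.comp_zero, LinearMap.zero_apply]
  have hAB : Commute A B := LinearMap.ext fun φ ↦ rfl
  have : commutatorEnd S T = A - B := rfl
  rw [this]
  exact hA.sub_of_commute hAB hB

/-- A vector which a commuting family of semisimple endomorphisms moves into an invariant
subspace `Z` can be corrected by an element of `Z` to a vector killed by the whole family. -/
lemma exists_mem_forall_apply_add_eq_zero [FiniteDimensional K V] {T : ι → End K V}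
    (hcomm : ∀ i j, Commute (T i) (T j)) (hss : ∀ i, (T i).IsSemisimple) (Z : Submodule K V)
    (hZ : ∀ i, ∀ z ∈ Z, T i z ∈ Z) (v : V) (hv : ∀ i, T i v ∈ Z) :
    ∃ z ∈ Z, ∀ i, T i (v + z) = 0 := by
  induction hd : finrank K Z using Nat.strong_induction_on generalizing Z v with
  | _ d ih =>
  subst hd
  by_cases h0 : ∀ i, T i v = 0
  · exact ⟨0, Z.zero_mem, by simpa using h0⟩
  push Not at h0
  obtain ⟨i, hi⟩ := h0
  obtain ⟨C, hC, hZC⟩ := Module.End.isSemisimple_iff.mp (hss i) Z (hZ i)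
  obtain ⟨z, hz, c, hc, rfl⟩ := Submodule.mem_sup.mp
    (hZC.sup_eq_top ▸ Submodule.mem_top : v ∈ Z ⊔ C)
  have hTc (j) : T j c ∈ Z := by
    have := Z.sub_mem (hv j) (hZ j z hz)
    rwa [map_add, add_sub_cancel_left] at this
  have hTic : T i c = 0 := Submodule.disjoint_def.mp hZC.disjoint _ (hTc i) (hC hc)
  have hswap (j : ι) (x : V) : T i (T j x) = T j (T i x) := LinearMap.congr_fun (hcomm i j) x
  obtain ⟨z', hz', h⟩ := ih _ (Submodule.finrank_lt_finrank_of_lt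
    (lt_of_le_of_ne (inf_le_left : Z ⊓ LinearMap.ker (T i) ≤ Z) fun h ↦ hi (by
      have : z ∈ LinearMap.ker (T i) := (inf_eq_left.mp h) hz
      rw [map_add, hTic, LinearMap.mem_ker.mp this, add_zero])))
    (Z ⊓ LinearMap.ker (T i))
    (fun j x hx ↦ ⟨hZ j x hx.1, LinearMap.mem_ker.mpr <| by
      rw [hswap, LinearMap.mem_ker.mp hx.2, map_zero]⟩) c
    (fun j ↦ ⟨hTc j, LinearMap.mem_ker.mpr <| by rw [hswap, hTic, map_zero]⟩) rfl
  exact ⟨z' - z, Z.sub_mem hz'.1 hz, fun j ↦ by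
    rw [← h j]
    congr 1
    abel⟩

end Semisimple

section InvariantSplitting

variable {K L S ι : Type*} [Field K] [LieRing L] [LieAlgebra K L] [FiniteDimensional K L]
  [LieRing S] [LieAlgebra K S] {f : L →ₗ⁅K⁆ S} {D : ι → End K L} {E : ι → End K S}

/-- A surjection onto a semisimple Lie algebra with solvable kernel splits. -/
lemma exists_section_of_isSolvable_ker [CharZero K] [FiniteDimensional K S]
    [HasTrivialRadical K S] (hf : Function.Surjective f) [IsSolvable f.ker] :
    ∃ σ : S →ₗ⁅K⁆ L, ∀ x, f (σ x) = x := by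
  induction hd : finrank K L using Nat.strong_induction_on generalizing L with
  | _ d ih =>
  subst hd
  by_cases hbot : f.ker = ⊥
  · let e := LieEquiv.ofBijective f ⟨(LieHom.ker_eq_bot f).mp hbot, hf⟩
    exact ⟨e.symm, e.apply_symm_apply⟩
  by_cases hmin : ∀ n : LieIdeal K L, n ≤ f.ker → n = ⊥ ∨ n = f.ker
  · have : IsLieAbelian f.ker := (LieSubmodule.lie_abelian_iff_lie_self_eq_bot f.ker).mpr <|
      (hmin _ (LieSubmodule.lie_le_left _ _)).resolve_right fun h ↦
        hbot (eq_bot_of_le_lie_self h.ge)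
    exact exists_section_of_isLieAbelian_of_minimal f hf hbot hmin
  push Not at hmin
  obtain ⟨n, hn, hn0, hn1⟩ := hmin
  have : HasInvariantSection f (fun i : Empty ↦ i.elim) (fun i ↦ i.elim) := by
    refine .of_quotient hn (fun i ↦ i.elim) (fun f' _ hf' _ ↦ ?_) fun L₁ _ hsurj hker ↦ ?_
    · have := isSolvable_ker_of_quotient hf'
      obtain ⟨σ, hσ⟩ := ih _ (finrank_quotient_lt hn0) (L := L ⧸ n) (f := f')
        (fun y ↦ (hf y).elim fun x hx ↦ ⟨_, (hf' x).trans hx⟩) rfl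
      exact ⟨σ, hσ, fun i ↦ i.elim⟩
    · have := isSolvable_ker_comp_incl (f := f) L₁
      obtain ⟨σ, hσ⟩ := ih _ (finrank_lt_of_ker_not_le (fun h ↦ hn1 (hn.antisymm h)) hker)
        hsurj rfl
      exact ⟨σ, hσ, fun i ↦ i.elim⟩
  obtain ⟨σ, hσ, -⟩ := this
  exact ⟨σ, hσ⟩

/-- A section of a surjection with abelian kernel can be made invariant under a commuting family
of semisimple derivations. -/
lemma HasInvariantSection.of_isLieAbelian [PerfectField K] [FiniteDimensional K S]
    (hf : Function.Surjective f) [IsLieAbelian f.ker]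
    (hD : ∀ i x y, D i ⁅x, y⁆ = ⁅D i x, y⁆ + ⁅x, D i y⁆)
    (hcomm : ∀ i j, Commute (D i) (D j)) (hss : ∀ i, (D i).IsSemisimple)
    (hE : ∀ i x, E i (f x) = f (D i x)) {σ : S →ₗ⁅K⁆ L} (hσ : ∀ x, f (σ x) = x) :
    HasInvariantSection f D E := by
  have habel {a b : L} (ha : f a = 0) (hb : f b = 0) : ⁅a, b⁆ = 0 :=
    congrArg Subtype.val (trivial_lie_zero f.ker f.ker ⟨a, ha⟩ ⟨b, hb⟩)
  have hED (i) (x y : S) : E i ⁅x, y⁆ = ⁅E i x, y⁆ + ⁅x, E i y⁆ := by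
    obtain ⟨x, rfl⟩ := hf x
    obtain ⟨y, rfl⟩ := hf y
    rw [← f.map_lie, hE, hD, map_add, f.map_lie, f.map_lie, hE, hE]
  have hEss (i) : (E i).IsSemisimple := (hss i).of_surjective (f := f.toLinearMap) hf (hE i)
  have hDc (i j) (x : L) : D i (D j x) = D j (D i x) := LinearMap.congr_fun (hcomm i j) x
  have hEc (i j) (x : S) : E i (E j x) = E j (E i x) := by
    obtain ⟨x, rfl⟩ := hf x
    simp_rw [hE, hDc i j]
  let Z : Submodule K (S →ₗ[K] L) :=
    { carrier := {δ | (∀ x, f (δ x) = 0) ∧ ∀ x y, δ ⁅x, y⁆ = ⁅σ x, δ y⁆ + ⁅δ x, σ y⁆}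
      add_mem' := fun {a b} ha hb ↦ ⟨fun x ↦ by simp [ha.1, hb.1], fun x y ↦ by
        simp only [LinearMap.add_apply, ha.2, hb.2, lie_add, add_lie]
        abel⟩
      zero_mem' := by simp
      smul_mem' := fun t a ha ↦ ⟨fun x ↦ by simp [ha.1], fun x y ↦ by simp [ha.2]⟩ }
  let T (i) := commutatorEnd (D i) (E i)
  have hT (i) (φ : S →ₗ[K] L) (x : S) : T i φ x = D i (φ x) - φ (E i x) := rfl
  have hTσ (i) : T i σ.toLinearMap ∈ Z := by
    refine ⟨fun x ↦ ?_, fun x y ↦ ?_⟩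
    · simp [hT, ← hE, hσ]
    · simp only [hT, LieHom.coe_toLinearMap, hED, map_add, LieHom.map_lie, hD, lie_sub, sub_lie]
      abel
  have hTZ (i) (δ) (hδ : δ ∈ Z) : T i δ ∈ Z := by
    refine ⟨fun x ↦ by simp [hT, ← hE, hδ.1], fun x y ↦ ?_⟩
    have h₁ := habel ((hTσ i).1 x) (hδ.1 y)
    have h₂ := habel (hδ.1 x) ((hTσ i).1 y)
    simp only [hT, LieHom.coe_toLinearMap, lie_sub, sub_lie, sub_eq_zero] at h₁ h₂
    simp only [hT, hED, map_add, hδ.2, hD, lie_sub, sub_lie, h₁, h₂]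
    abel
  obtain ⟨δ, hδ, h⟩ := exists_mem_forall_apply_add_eq_zero (T := T)
    (fun i j ↦ LinearMap.ext fun φ ↦ LinearMap.ext fun x ↦ by
      simp only [Module.End.mul_apply, hT, map_sub, hDc i j, hEc i j]
      abel)
    (fun i ↦ isSemisimple_commutatorEnd (hss i) (hEss i)) Z hTZ σ hTσ
  refine ⟨{ (σ : S →ₗ[K] L) + δ with map_lie' := fun {x y} ↦ ?_ }, fun x ↦ ?_, fun i x ↦ ?_⟩
  · change σ ⁅x, y⁆ + δ ⁅x, y⁆ = ⁅σ x + δ x, σ y + δ y⁆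
    rw [lie_add, add_lie, add_lie, habel (hδ.1 x) (hδ.1 y), σ.map_lie, hδ.2]
    abel
  · change f (σ x + δ x) = x
    rw [map_add, hσ, hδ.1, add_zero]
  · exact sub_eq_zero.mp (LinearMap.congr_fun (h i) x)

/-- A surjection onto a semisimple Lie algebra with solvable kernel admits a section that is
invariant under a given commuting family of semisimple derivations preserving the kernel. -/
theorem hasInvariantSection_of_isSolvable_ker [CharZero K] [FiniteDimensional K S]
    [HasTrivialRadical K S] (hf : Function.Surjective f) [IsSolvable f.ker]
    (hD : ∀ i x y, D i ⁅x, y⁆ = ⁅D i x, y⁆ + ⁅x, D i y⁆)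
    (hcomm : ∀ i j, Commute (D i) (D j)) (hss : ∀ i, (D i).IsSemisimple)
    (hE : ∀ i x, E i (f x) = f (D i x)) : HasInvariantSection f D E := by
  induction hd : finrank K L using Nat.strong_induction_on generalizing L with
  | _ d ih =>
  subst hd
  by_cases hab : ⁅f.ker, f.ker⁆ = ⊥
  · have : IsLieAbelian f.ker := (LieSubmodule.lie_abelian_iff_lie_self_eq_bot f.ker).mpr hab
    obtain ⟨σ, hσ⟩ := exists_section_of_isSolvable_ker hf
    exact .of_isLieAbelian hf hD hcomm hss hE hσ
  have hker (i) (x : L) (hx : x ∈ f.ker) : D i x ∈ f.ker := by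
    rw [LieHom.mem_ker] at hx ⊢
    rw [← hE, hx, map_zero]
  have hder (i) : (⁅f.ker, f.ker⁆ : LieIdeal K L).toSubmodule ≤
      (⁅f.ker, f.ker⁆ : LieIdeal K L).toSubmodule.comap (D i) := by
    conv_lhs => rw [LieSubmodule.lieIdeal_oper_eq_linear_span']
    rw [Submodule.span_le]
    rintro _ ⟨x, hx, y, hy, rfl⟩
    change D i ⁅x, y⁆ ∈ ⁅f.ker, f.ker⁆
    rw [hD]
    exact add_mem (LieSubmodule.lie_mem_lie (hker i x hx) hy)
      (LieSubmodule.lie_mem_lie hx (hker i y hy))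
  have hnot : ¬ f.ker ≤ ⁅f.ker, f.ker⁆ := fun h ↦ hab <| by
    rw [eq_bot_of_le_lie_self h, LieSubmodule.bot_lie]
  refine .of_quotient (LieSubmodule.lie_le_left _ _) (fun i ↦ hder i)
    (fun f' D' hf' hD' ↦ ?_) fun L₁ hDL₁ hsurj hker₁ ↦ ?_
  · have := isSolvable_ker_of_quotient hf'
    have hmk := LieSubmodule.Quotient.surjective_mk' ⁅f.ker, f.ker⁆
    refine ih _ (finrank_quotient_lt hab) (L := L ⧸ ⁅f.ker, f.ker⁆) (f := f') (D := D')
      (fun y ↦ (hf y).elim fun x hx ↦ ⟨_, (hf' x).trans hx⟩) ?_ ?_ ?_ ?_ rfl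
    · intro i x y
      obtain ⟨x, rfl⟩ := hmk x
      obtain ⟨y, rfl⟩ := hmk y
      simp only [LieSubmodule.Quotient.mk'_apply, ← LieSubmodule.Quotient.mk_bracket, hD', hD]
      rfl
    · refine fun i j ↦ LinearMap.ext fun x ↦ ?_
      obtain ⟨x, rfl⟩ := hmk x
      simp only [Module.End.mul_apply, LieSubmodule.Quotient.mk'_apply, hD']
      exact congrArg _ (LinearMap.congr_fun (hcomm i j) x)
    · exact fun i ↦ (hss i).of_surjective
        (f := (LieSubmodule.Quotient.mk' ⁅f.ker, f.ker⁆).toLinearMap) hmk (hD' i)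
    · intro i x
      obtain ⟨x, rfl⟩ := hmk x
      simp only [LieSubmodule.Quotient.mk'_apply, hD', hf', hE]
  · have := isSolvable_ker_comp_incl (f := f) L₁
    exact ih _ (finrank_lt_of_ker_not_le hnot hker₁) hsurj
      (fun i x y ↦ Subtype.ext (hD i x y))
      (fun i j ↦ LinearMap.ext fun x ↦ Subtype.ext (LinearMap.congr_fun (hcomm i j) (x : L)))
      (fun i ↦ (hss i).restrict _) (fun i x ↦ hE i x) rfl

end InvariantSplitting

section Radical

variable (K L : Type*) [Field K] [LieRing L] [LieAlgebra K L] [FiniteDimensional K L]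

/-- The quotient of a Lie algebra by its radical has trivial radical. -/
lemma hasTrivialRadical_quotient_radical : HasTrivialRadical K (L ⧸ radical K L) := by
  let π : L →ₗ⁅K⁆ L ⧸ radical K L :=
    { (radical K L).toSubmodule.mkQ with
      map_lie' := fun {x y} ↦ LieSubmodule.Quotient.mk_bracket _ x y }
  have hπ (x : L) : π x = 0 ↔ x ∈ radical K L := LieSubmodule.Quotient.mk_eq_zero'
  have hπsurj : Function.Surjective π := LieSubmodule.Quotient.surjective_mk' _
  refine hasTrivialRadical_of_no_solvable_ideals fun J hJ ↦ ?_
  obtain ⟨k, hk⟩ := IsSolvable.solvable K J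
  obtain ⟨l, hl⟩ := IsSolvable.solvable K (radical K L)
  rw [LieIdeal.derivedSeries_eq_bot_iff] at hk hl
  have hmap (m : ℕ) : (derivedSeriesOfIdeal K L m (J.comap π)).map π ≤
      derivedSeriesOfIdeal K _ m J := by
    induction m with
    | zero => exact LieIdeal.map_comap_le
    | succ m ih =>
      rw [derivedSeriesOfIdeal_succ, derivedSeriesOfIdeal_succ]
      exact (LieIdeal.map_bracket_le π).trans (LieSubmodule.mono_lie ih ih)
  have hle : derivedSeriesOfIdeal K L k (J.comap π) ≤ radical K L := fun x hx ↦ by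
    have := hmap k (LieIdeal.mem_map hx)
    rwa [hk, LieSubmodule.mem_bot, hπ] at this
  have : IsSolvable (J.comap π) := by
    refine IsSolvable.mk (R := K) (k := l + k) ?_
    rw [LieIdeal.derivedSeries_eq_bot_iff, derivedSeriesOfIdeal_add, eq_bot_iff, ← hl]
    exact derivedSeriesOfIdeal_mono hle l
  refine (LieSubmodule.eq_bot_iff J).mpr fun y hy ↦ ?_
  obtain ⟨x, rfl⟩ := hπsurj y
  exact (hπ x).mpr (((LieIdeal.solvable_iff_le_radical K L _).mp this) (LieIdeal.mem_comap.mpr hy))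

end Radical

/-- If `a` is an abelian Lie subalgebra of `g` such that `ad H` is a semisimple endomorphism
of `g` for every `H ∈ a`, then some Levi subalgebra of `g` is `ad(a)`-invariant. -/
theorem exists_ad_invariant_levi_of_abelian_semisimple_subalgebra
    (g : Type*) [LieRing g] [LieAlgebra ℝ g] [FiniteDimensional ℝ g]
    (a : LieSubalgebra ℝ g) (hab : IsLieAbelian a)
    (hss : ∀ H ∈ a, Module.End.IsSemisimple (LieAlgebra.ad ℝ g H)) :
    ∃ l : LieSubalgebra ℝ g, IsLeviSubalgebra g l ∧
      ∀ H ∈ a, ∀ x ∈ l, ⁅H, x⁆ ∈ l := by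
  have := hasTrivialRadical_quotient_radical ℝ g
  let π : g →ₗ⁅ℝ⁆ g ⧸ radical ℝ g :=
    { (radical ℝ g).toSubmodule.mkQ with
      map_lie' := fun {x y} ↦ LieSubmodule.Quotient.mk_bracket _ x y }
  have hπ (x : g) : π x = 0 ↔ x ∈ radical ℝ g := LieSubmodule.Quotient.mk_eq_zero'
  have hπsurj : Function.Surjective π := LieSubmodule.Quotient.surjective_mk' _
  have hker : π.ker = radical ℝ g := LieSubmodule.ext _ _ fun x ↦ hπ x
  have : IsSolvable π.ker := (LieIdeal.solvable_iff_le_radical ℝ g _).mpr hker.le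
  obtain ⟨σ, hσ, hinv⟩ := hasInvariantSection_of_isSolvable_ker hπsurj
    (D := fun H : a ↦ ad ℝ g H) (E := fun H : a ↦ ad ℝ _ (π H))
    (fun H x y ↦ by simp)
    (fun H H' ↦ LinearMap.ext fun x ↦ by
      have : ⁅(H : g), (H' : g)⁆ = 0 := congrArg Subtype.val (trivial_lie_zero a a H H')
      have h := lie_lie (H : g) (H' : g) x
      rw [this, zero_lie, eq_comm, sub_eq_zero] at h
      exact h)
    (fun H ↦ hss H H.2) (fun H x ↦ (π.map_lie H x).symm)
  have hσinj : Function.Injective σ := Function.LeftInverse.injective hσ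
  refine ⟨σ.range, ⟨?_, ?_, ?_⟩, ?_⟩
  · have : IsKilling ℝ σ.range := isKilling_of_equiv (LieEquiv.ofInjective σ hσinj)
    infer_instance
  · rw [Submodule.disjoint_def]
    rintro _ ⟨y, rfl⟩ hy
    have : y = 0 := (hσ y).symm.trans ((hπ _).mpr hy)
    exact (congrArg σ this).trans (map_zero σ)
  · rw [codisjoint_iff, eq_top_iff]
    refine fun x _ ↦ Submodule.mem_sup.mpr ⟨σ (π x), ⟨π x, rfl⟩, x - σ (π x), ?_, by abel⟩
    exact (hπ _).mp (by rw [map_sub, hσ, sub_self])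
  · rintro H hH _ ⟨y, rfl⟩
    exact ⟨_, (hinv ⟨H, hH⟩ y).symm⟩
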